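/- (Alikhanov's inequality, Hilbert-space form.) Let H be a real Hilbert space, T > 0, 0 < α < 1, and let w : [0,T] → H be absolutely continuous, i.e. w(t) = w(0) + ∫₀^t w'(s) ds with w' : (0,T) → H Bochner integrable. Then for almost every t ∈ (0,T] (namely at every t at which ∫₀^t (t−s)^{−α} ‖w'(s)‖ ds is finite) one has (1/2) D^α(‖w(·)‖²)(t) ≤ ⟨w(t), D^α w(t)⟩, that is, (1/Γ(1−α)) ∫₀^t (t−s)^{−α} ⟨w(s), w'(s)⟩ ds ≤ ⟨ w(t), (1/Γ(1−α)) ∫₀^t (t−s)^{−α} w'(s) ds ⟩. -/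

import Mathlib

open MeasureTheory Set
open scoped RealInnerProductSpace

theorem alik_aux1 {H : Type*} [NormedAddCommGroup H] [InnerProductSpace ℝ H] [CompleteSpace H]
    (g : ℝ → H) (c t : ℝ) (hg : IntegrableOn g (Ioo c t)) :
    0 ≤ ∫ s in Ioo c t, ⟪∫ r in Ioo s t, g r, g s⟫ := by
  set μ := (volume : Measure ℝ).restrict (Ioo c t) with hμ
  have hG : Integrable (fun p : ℝ × ℝ => ⟪g p.1, g p.2⟫) (μ.prod μ) :=
    Integrable.op_fst_snd (op := fun x y : H => ⟪x, y⟫) (by fun_prop)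
      ⟨1, fun x y => by simpa using norm_inner_le_norm (𝕜 := ℝ) x y⟩ hg hg
  set A : Set (ℝ × ℝ) := {p | p.1 < p.2} with hA
  set B : Set (ℝ × ℝ) := {p | p.2 < p.1} with hB
  have mA : MeasurableSet A := measurableSet_lt measurable_fst measurable_snd
  have mB : MeasurableSet B := measurableSet_lt measurable_snd measurable_fst
  set G : ℝ × ℝ → ℝ := fun p => ⟪g p.1, g p.2⟫ with hGdef
  have h1 : ∫ s, ⟪∫ r in Ioo s t, g r, g s⟫ ∂μ = ∫ p, A.indicator G p ∂(μ.prod μ) := by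
    rw [integral_prod _ (hG.indicator mA)]
    apply setIntegral_congr_fun measurableSet_Ioo
    intro s hs
    have e1 : ∫ r in Ioo s t, g r = ∫ r, (Ioi s).indicator g r ∂μ := by
      rw [integral_indicator measurableSet_Ioi, hμ, Measure.restrict_restrict measurableSet_Ioi]
      congr 2
      ext x; simp only [mem_Ioo, mem_inter_iff, mem_Ioi] at hs ⊢
      constructor
      · rintro ⟨a, b⟩; exact ⟨a, by linarith, b⟩
      · rintro ⟨a, _, b⟩; exact ⟨a, b⟩
    simp only
    rw [e1, real_inner_comm, ← integral_inner (Integrable.indicator hg measurableSet_Ioi)]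
    congr 1
    ext r
    by_cases h : s < r <;> simp [indicator, hA, hGdef, h]
  have h2 : ∫ p, A.indicator G p ∂(μ.prod μ) = ∫ p, B.indicator G p ∂(μ.prod μ) := by
    rw [← integral_prod_swap]
    congr 1
    ext p
    simp only [indicator, hA, hB, hGdef, mem_ofPred_eq, Prod.fst_swap, Prod.snd_swap]
    rw [real_inner_comm]
  have h3 : ∫ p, A.indicator G p ∂(μ.prod μ) + ∫ p, B.indicator G p ∂(μ.prod μ)
      = ∫ p, G p ∂(μ.prod μ) := by
    rw [← integral_add (hG.indicator mA) (hG.indicator mB)]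
    apply integral_congr_ae
    have hd : ∀ᵐ p ∂(μ.prod μ), p.1 ≠ p.2 := by
      rw [Measure.ae_prod_iff_ae_ae]
      · refine Filter.Eventually.of_forall fun x => ?_
        have : ∀ᵐ y ∂μ, y ≠ x := by
          rw [ae_iff]; simp
        filter_upwards [this] with y hy using hy.symm
      · exact (measurableSet_eq_fun measurable_fst measurable_snd).compl
    filter_upwards [hd] with p hp
    rcases lt_or_gt_of_ne hp with h | h
    · simp [indicator, hA, hB, h, not_lt.2 h.le]
    · simp [indicator, hA, hB, h, not_lt.2 h.le]
  have h4 : ∫ p, G p ∂(μ.prod μ) = ⟪∫ s, g s ∂μ, ∫ s, g s ∂μ⟫ := by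
    rw [integral_prod _ hG]
    simp only [hGdef]
    rw [real_inner_comm, ← integral_inner hg]
    congr 1
    ext x
    rw [integral_inner hg, real_inner_comm]
  have h5 : 0 ≤ ∫ p, G p ∂(μ.prod μ) := by rw [h4]; exact real_inner_self_nonneg
  rw [h1]; linarith

theorem alik_aux2 (f : ℝ → ℝ) (t α : ℝ) (ht : 0 < t) (hα0 : 0 < α)
    (hf : IntegrableOn f (Ioo 0 t))
    (hkf : IntegrableOn (fun s => (t - s) ^ (-α) * f s) (Ioo 0 t))
    (hpos : ∀ c, 0 ≤ c → c < t → 0 ≤ ∫ s in Ioo c t, f s) :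
    0 ≤ ∫ s in Ioo 0 t, (t - s) ^ (-α) * f s := by
  set μ := (volume : Measure ℝ).restrict (Ioo 0 t) with hμ
  set ν := (volume : Measure ℝ).restrict (Ioi 0) with hν
  set A : Set (ℝ × ℝ) := {p | p.2 < (t - p.1) ^ (-α)} with hA
  have mA : MeasurableSet A := measurableSet_lt measurable_snd (by fun_prop)
  set F : ℝ × ℝ → ℝ := A.indicator (fun p => f p.1) with hF
  have hFm : AEStronglyMeasurable F (μ.prod ν) :=
    (hf.aestronglyMeasurable.comp_fst).indicator mA
  have hin : ∀ s ∈ Ioo 0 t, ∀ y : ℝ, ∫ l, (Iio ((t - s) ^ (-α))).indicator (fun _ => y) l ∂ν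
      = (t - s) ^ (-α) * y := by
    intro s hs y
    rw [integral_indicator measurableSet_Iio, hν, Measure.restrict_restrict measurableSet_Iio]
    have hk : 0 ≤ (t - s) ^ (-α) := Real.rpow_nonneg (by linarith [hs.2]) _
    rw [Iio_inter_Ioi]
    simp [hk]
  have hFs : ∀ s l, F (s, l) = (Iio ((t - s) ^ (-α))).indicator (fun _ => f s) l := by
    intro s l; simp [hF, hA, indicator]
  have hFi : Integrable F (μ.prod ν) := by
    rw [integrable_prod_iff hFm]
    constructor
    · refine (ae_restrict_mem measurableSet_Ioo).mono fun s hs => ?_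
      simp only [hFs]
      rw [integrable_indicator_iff measurableSet_Iio, IntegrableOn, hν,
        Measure.restrict_restrict measurableSet_Iio, Iio_inter_Ioi]
      exact integrableOn_const (by simp)
    · refine hkf.norm.congr ?_
      refine (ae_restrict_mem measurableSet_Ioo).mono fun s hs => ?_
      have hk : 0 ≤ (t - s) ^ (-α) := Real.rpow_nonneg (by linarith [hs.2]) _
      simp only [hFs, norm_indicator_eq_indicator_norm]
      rw [hin s hs, norm_mul, Real.norm_of_nonneg hk]
  have e : ∫ s, (t - s) ^ (-α) * f s ∂μ = ∫ p, F p ∂(μ.prod ν) := by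
    rw [integral_prod _ hFi]
    refine setIntegral_congr_fun measurableSet_Ioo fun s hs => ?_
    simp only [hFs]
    rw [hin s hs]
  rw [e, integral_prod_symm _ hFi]
  refine setIntegral_nonneg measurableSet_Ioi fun l hl => ?_
  have hl : 0 < l := hl
  have hlp : 0 < l ^ (-α)⁻¹ := Real.rpow_pos_of_pos hl _
  have : ∫ s, F (s, l) ∂μ = ∫ s in Ioo (max 0 (t - l ^ (-α)⁻¹)) t, f s := by
    rw [← integral_indicator measurableSet_Ioo, ← integral_indicator measurableSet_Ioo]
    congr 1
    ext s
    by_cases hs : s ∈ Ioo 0 t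
    · have key : l < (t - s) ^ (-α) ↔ t - l ^ (-α)⁻¹ < s := by
        rw [← Real.lt_rpow_inv_iff_of_neg (by linarith [hs.2]) hl (by linarith)]
        constructor <;> intro h <;> linarith
      rw [indicator_of_mem hs]
      by_cases h : l < (t - s) ^ (-α)
      · have : s ∈ Ioo (max 0 (t - l ^ (-α)⁻¹)) t := ⟨max_lt hs.1 (key.1 h), hs.2⟩
        rw [indicator_of_mem this]; simp [hF, hA, indicator, h]
      · have : s ∉ Ioo (max 0 (t - l ^ (-α)⁻¹)) t := fun h' =>
          h (key.2 (lt_of_le_of_lt (le_max_right _ _) h'.1))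
        rw [indicator_of_notMem this]; simp [hF, hA, indicator, h]
    · have : s ∉ Ioo (max 0 (t - l ^ (-α)⁻¹)) t := fun h' =>
          hs ⟨lt_of_le_of_lt (le_max_left _ _) h'.1, h'.2⟩
      rw [indicator_of_notMem this, indicator_of_notMem hs]
  show 0 ≤ ∫ s, F (s, l) ∂μ
  rw [this]
  exact hpos _ (le_max_left _ _) (max_lt ht (by linarith))

/-- Alikhanov's inequality in Hilbert-space form: for `0 < α < 1` and an absolutely
continuous `w : [0,T] → H`, at every `t ∈ (0,T]` where `∫₀ᵗ (t−s)^{−α} ‖w'(s)‖ ds` is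
finite one has `(1/2) D^α (‖w‖²)(t) ≤ ⟨w(t), D^α w(t)⟩`. -/
theorem alikhanov_inequality
    {H : Type*} [NormedAddCommGroup H] [InnerProductSpace ℝ H] [CompleteSpace H]
    (T α : ℝ) (hT : 0 < T) (hα0 : 0 < α) (hα1 : α < 1)
    (w : ℝ → H) (w' : ℝ → H)
    (hint : IntegrableOn w' (Ioo 0 T))
    (hAC : ∀ t ∈ Icc (0 : ℝ) T, w t = w 0 + ∫ s in Ioo (0 : ℝ) t, w' s) :
    ∀ t ∈ Ioc (0 : ℝ) T,
      IntegrableOn (fun s => (t - s) ^ (-α) * ‖w' s‖) (Ioo 0 t) →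
      (1 / Real.Gamma (1 - α)) *
          ∫ s in Ioo (0 : ℝ) t, (t - s) ^ (-α) * ⟪w s, w' s⟫
        ≤ ⟪w t, (1 / Real.Gamma (1 - α)) •
            ∫ s in Ioo (0 : ℝ) t, (t - s) ^ (-α) • w' s⟫ := by
  intro t ht hk
  have hgt : IntegrableOn w' (Ioo 0 t) := hint.mono_set (Ioo_subset_Ioo_right ht.2)
  have hΓ : 0 ≤ 1 / Real.Gamma (1 - α) := by
    have := Real.Gamma_pos_of_pos (sub_pos.2 hα1)
    positivity
  rw [real_inner_smul_right]
  refine mul_le_mul_of_nonneg_left ?_ hΓ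
  -- continuity of w
  have hwc : ContinuousOn w (Icc 0 t) := by
    have h := intervalIntegral.continuousOn_primitive (μ := volume) (f := w') (a := 0) (b := t)
      (by rwa [integrableOn_Icc_iff_integrableOn_Ioo])
    refine (continuousOn_const (c := w 0)).add h |>.congr fun x hx => ?_
    simp only [Pi.add_apply, integral_Ioc_eq_integral_Ioo]
    exact hAC x ⟨hx.1, hx.2.trans ht.2⟩
  obtain ⟨C, hC⟩ := isCompact_Icc.exists_bound_of_continuousOn hwc
  have hwm : AEStronglyMeasurable w (volume.restrict (Ioo 0 t)) :=
    (hwc.mono Ioo_subset_Icc_self).aestronglyMeasurable measurableSet_Ioo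
  have hkm : AEStronglyMeasurable (fun s : ℝ => (t - s) ^ (-α)) (volume.restrict (Ioo 0 t)) :=
    Measurable.aestronglyMeasurable (by fun_prop)
  have hkw : IntegrableOn (fun s => (t - s) ^ (-α) • w' s) (Ioo 0 t) := by
    refine Integrable.mono' hk (hkm.smul hgt.aestronglyMeasurable) ?_
    refine (ae_restrict_mem measurableSet_Ioo).mono fun s hs => ?_
    rw [norm_smul, Real.norm_of_nonneg (Real.rpow_nonneg (by linarith [hs.2]) _)]
  have hi : ∀ g : ℝ → H, IntegrableOn g (Ioo 0 t) →
      IntegrableOn (fun s => ⟪w s, g s⟫) (Ioo 0 t) := by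
    intro g hg
    refine Integrable.mono' (hg.norm.const_mul C) (hwm.inner hg.aestronglyMeasurable) ?_
    refine (ae_restrict_mem measurableSet_Ioo).mono fun s hs => ?_
    exact (norm_inner_le_norm _ _).trans
      (mul_le_mul_of_nonneg_right (hC s (Ioo_subset_Icc_self hs)) (norm_nonneg _))
  have hc : ∀ g : ℝ → H, IntegrableOn g (Ioo 0 t) →
      IntegrableOn (fun s => ⟪w t, g s⟫) (Ioo 0 t) := fun g hg => Integrable.const_inner _ hg
  have hkf1 := hi _ hkw
  have hkf2 := hc _ hkw
  have main := alik_aux2 (fun s => ⟪w t, w' s⟫ - ⟪w s, w' s⟫) t α ht.1 hα0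
    ((hc _ hgt).sub (hi _ hgt))
    (by
      refine (hkf2.sub hkf1).congr (Filter.Eventually.of_forall fun s => ?_)
      simp only [Pi.sub_apply, real_inner_smul_right]; ring)
    (by
      intro c hc0 hct
      have := alik_aux1 w' c t (hgt.mono_set (Ioo_subset_Ioo_left hc0))
      refine this.trans_eq (setIntegral_congr_fun measurableSet_Ioo fun s hs => ?_)
      rw [← inner_sub_left]
      congr 1
      have hs0 : 0 ≤ s := hc0.trans hs.1.le
      rw [hAC t ⟨ht.1.le, ht.2⟩, hAC s ⟨hs0, hs.2.le.trans ht.2⟩]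
      have hu : ∫ r in Ioc 0 t, w' r = (∫ r in Ioc 0 s, w' r) + ∫ r in Ioc s t, w' r := by
        have hI : IntegrableOn w' (Ioc 0 t) := by rwa [integrableOn_Ioc_iff_integrableOn_Ioo]
        rw [← Ioc_union_Ioc_eq_Ioc hs0 hs.2.le]
        exact setIntegral_union (Ioc_disjoint_Ioc_of_le le_rfl) measurableSet_Ioc
          (hI.mono_set (Ioc_subset_Ioc_right hs.2.le)) (hI.mono_set (Ioc_subset_Ioc_left hs0))
      simp only [integral_Ioc_eq_integral_Ioo] at hu
      rw [hu]; abel)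
  have e1 : ∫ s in Ioo 0 t, (t - s) ^ (-α) * (⟪w t, w' s⟫ - ⟪w s, w' s⟫)
      = ⟪w t, ∫ s in Ioo (0 : ℝ) t, (t - s) ^ (-α) • w' s⟫
        - ∫ s in Ioo (0 : ℝ) t, (t - s) ^ (-α) * ⟪w s, w' s⟫ := by
    rw [← integral_inner hkw]
    simp only [real_inner_smul_right] at hkf1 hkf2 ⊢
    rw [← integral_sub hkf2 hkf1]
    simp only [mul_sub]
  rw [e1] at main
  linarith
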